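/- Let K be a field with char K ≠ 2 and let D ∈ S_K be a Pellian polynomial. Let (X, Y) be a non-trivial solution of the Pell equation for D with X² − D·Y² = t ∈ {1, −1}, the sign of Y chosen so that ord(X + Y·√D) < 0. Let Z ∈ K[T] be coprime to X with deg Z < deg X, let Z/X = [0, a_1, …, a_n] be its regular continued fraction expansion, and let k ∈ K \ {0} be the constant such that the continuants (p_n, q_n) of this expansion satisfy p_n = k·Z and q_n = k·X. Then the infinite periodic continued fraction obtained by repeating the block (2/k, −a_1, …, −a_n, (−1)^{n+1}·2t/k, a_n, …, a_1) converges in K((T⁻¹)) to β = (X − k·Z + Y·√D)/(k·X); in particular K(β) ≤ K(Z/X). -/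

import Mathlib

noncomputable section

namespace PaperCF

variable {K : Type*} [Field K]

/-- The element `T` of `K((T⁻¹))`, where `K((T⁻¹))` is modeled as the field
`LaurentSeries K` of Laurent series in the variable `t = T⁻¹`. -/
def Tvar (K : Type*) [Field K] : LaurentSeries K := (HahnSeries.single (-1 : ℤ) (1 : K))

/-- The embedding of `K[T]` into `K((T⁻¹))`, sending the polynomial variable to `T = t⁻¹`. -/
def emb : Polynomial K →+* LaurentSeries K := (Polynomial.aeval (Tvar K)).toRingHom

/-- The polynomial part `⌊α⌋` of a formal Laurent series `α ∈ K((T⁻¹))`. -/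
def polyPart (α : LaurentSeries K) : Polynomial K :=
  ∑ i ∈ Finset.range ((-α.order).toNat + 1), Polynomial.monomial i (α.coeff (-(i : ℤ)))

/-- The complete quotients `αₙ` of the regular continued fraction expansion of `α`
(with the convention `0⁻¹ = 0`, so that `cq α n = 0` for all `n` past the end of a
finite expansion). -/
def cq (α : LaurentSeries K) : ℕ → LaurentSeries K
  | 0 => α
  | n + 1 => (cq α n - emb (polyPart (cq α n)))⁻¹

/-- The partial quotients `aₙ = ⌊αₙ⌋` of the regular continued fraction expansion of `α`. -/
def pq (α : LaurentSeries K) (n : ℕ) : Polynomial K := polyPart (cq α n)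

/-- The continuants `(pₙ, qₙ)` of the regular continued fraction expansion of `α`. -/
def cont (α : LaurentSeries K) : ℕ → Polynomial K × Polynomial K
  | 0 => (pq α 0, 1)
  | 1 => (pq α 1 * pq α 0 + 1, pq α 1)
  | n + 2 => (pq α (n + 2) * (cont α (n + 1)).1 + (cont α n).1,
              pq α (n + 2) * (cont α (n + 1)).2 + (cont α n).2)

/-- `pₙ`. -/
def contP (α : LaurentSeries K) (n : ℕ) : Polynomial K := (cont α n).1

/-- `qₙ`. -/
def contQ (α : LaurentSeries K) (n : ℕ) : Polynomial K := (cont α n).2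

/-- The `n`-th partial quotient (and hence the `n`-th convergent) of `α` genuinely exists. -/
def ConvAt (α : LaurentSeries K) (n : ℕ) : Prop := n = 0 ∨ cq α n ≠ 0

/-- `K(α) = sup_{n ≥ 1} deg aₙ`, as an extended natural number. -/
def KK (α : LaurentSeries K) : ℕ∞ :=
  ⨆ n : {n : ℕ // 1 ≤ n ∧ cq α n ≠ 0}, ((pq α n.1).natDegree : ℕ∞)

/-- `ōK(α) = limsup_n deg aₙ`. -/
def KKbar (α : LaurentSeries K) : ℕ∞ :=
  Filter.limsup (fun n => ((pq α n).natDegree : ℕ∞)) Filter.atTop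

/-- `α` is a rational function, i.e. an element of `K(T) ⊆ K((T⁻¹))`. -/
def IsRat (α : LaurentSeries K) : Prop :=
  ∃ p q : Polynomial K, q ≠ 0 ∧ α * emb q = emb p

/-- Two Laurent series are equivalent if they differ by a Möbius transformation with
matrix in `GL₂(K[T])`. -/
def MEquiv (α β : LaurentSeries K) : Prop :=
  ∃ a b c d : Polynomial K, IsUnit (a * d - b * c) ∧
    emb c * α + emb d ≠ 0 ∧ β = (emb a * α + emb b) / (emb c * α + emb d)

end PaperCF

namespace PaperCF

variable {K : Type*} [Field K]

/-- Value of a finite continued fraction `[x₀, x₁, …, xₘ] = x₀ + 1/(x₁ + 1/(⋯ + 1/xₘ))`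
(with the convention `0⁻¹ = 0`). -/
def cfEval (l : List (LaurentSeries K)) : LaurentSeries K :=
  l.foldr (fun x acc => x + acc⁻¹) 0

/-- The block `(2/k, −a₁, …, −aₙ, (−1)^{n+1}·2t/k, aₙ, …, a₁)` of length `2n + 2`
(entries indexed by `0, …, 2n + 1`), where `aᵢ = a i`. -/
def mercatBlock (a : ℕ → Polynomial K) (n : ℕ) (t k : K) (i : ℕ) : Polynomial K :=
  if i = 0 then Polynomial.C (2 * k⁻¹)
  else if i ≤ n then - a i
  else if i = n + 1 then Polynomial.C ((-1) ^ (n + 1) * 2 * t * k⁻¹)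
  else a (2 * n + 2 - i)

/-- The value of the finite continued fraction formed by the first `m + 1` terms of the
sequence of polynomials `s`. -/
def cfTrunc (s : ℕ → Polynomial K) (m : ℕ) : LaurentSeries K :=
  cfEval ((List.range (m + 1)).map fun i => emb (s i))

end PaperCF

namespace PaperCF

variable {K : Type*} [Field K]

theorem emb_monomial (i : ℕ) (c : K) :
    emb (Polynomial.monomial i c) = HahnSeries.single (-(i : ℤ)) c := by
  have h : algebraMap K (LaurentSeries K) c = HahnSeries.single 0 c := by
    rw [HahnSeries.algebraMap_apply']; simp
  simp [emb, Tvar, Polynomial.aeval_monomial, HahnSeries.single_pow, h]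

theorem coeff_emb (p : Polynomial K) (j : ℤ) :
    (emb p).coeff j = if j ≤ 0 then p.coeff (-j).toNat else 0 := by
  induction p using Polynomial.induction_on' with
  | add p q hp hq => rw [map_add, HahnSeries.coeff_add, hp, hq]; split_ifs <;> simp
  | monomial i c =>
    rw [emb_monomial, HahnSeries.coeff_single, Polynomial.coeff_monomial]
    split_ifs <;> first | rfl | omega

theorem emb_injective : Function.Injective (emb (K := K)) := by
  intro p q h
  ext i
  have := congrArg (fun α : LaurentSeries K => α.coeff (-(i : ℤ))) h
  simpa [coeff_emb] using this

theorem emb_ne_zero {p : Polynomial K} (hp : p ≠ 0) : emb p ≠ 0 :=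
  (map_ne_zero_iff emb emb_injective).2 hp

theorem orderTop_emb {p : Polynomial K} (hp : p ≠ 0) :
    (emb p).orderTop = ((-(p.natDegree : ℤ) : ℤ) : WithTop ℤ) := by
  apply le_antisymm
  · apply HahnSeries.orderTop_le_of_coeff_ne_zero
    simpa [coeff_emb] using hp
  · rw [HahnSeries.le_orderTop_iff_forall]
    intro j hj
    rw [WithTop.coe_lt_coe] at hj
    rw [coeff_emb, if_pos (by omega)]
    exact Polynomial.coeff_eq_zero_of_natDegree_lt (by omega)

theorem orderTop_emb_C_nonneg (v : K) : 0 ≤ (emb (Polynomial.C v)).orderTop := by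
  rcases eq_or_ne v 0 with rfl | hv
  · simp
  · rw [orderTop_emb (Polynomial.C_ne_zero.2 hv)]
    simp

theorem ne_zero_of_orderTop_eq_coe {x : LaurentSeries K} {m : ℤ}
    (h : x.orderTop = (m : WithTop ℤ)) : x ≠ 0 := by
  rintro rfl
  simp at h

theorem orderTop_inv {x : LaurentSeries K} {m : ℤ} (h : x.orderTop = (m : WithTop ℤ)) :
    (x⁻¹).orderTop = ((-m : ℤ) : WithTop ℤ) := by
  have hx := ne_zero_of_orderTop_eq_coe h
  have h1 : x.orderTop + (x⁻¹).orderTop = 0 := by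
    rw [← HahnSeries.orderTop_mul, mul_inv_cancel₀ hx, HahnSeries.orderTop_one]
  rw [h] at h1
  have hx' := HahnSeries.order_eq_orderTop_of_ne_zero (inv_ne_zero hx)
  rw [← hx'] at h1 ⊢
  norm_cast at h1 ⊢
  omega

theorem orderTop_mul_inv_pos {w y : LaurentSeries K} {m : ℤ} (hy : y.orderTop = (m : WithTop ℤ))
    (hw : (m : WithTop ℤ) < w.orderTop) : 0 < (w * y⁻¹).orderTop := by
  rw [HahnSeries.orderTop_mul, orderTop_inv hy]
  cases h : w.orderTop with
  | top => simp
  | coe d =>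
    rw [h] at hw
    norm_cast at hw ⊢
    omega

theorem coeff_polyPart (α : LaurentSeries K) (i : ℕ) :
    (polyPart α).coeff i = α.coeff (-(i : ℤ)) := by
  rw [polyPart, Polynomial.finsetSum_coeff]
  simp only [Polynomial.coeff_monomial]
  rw [Finset.sum_ite_eq']
  split_ifs with h
  · rfl
  · symm
    apply HahnSeries.coeff_eq_zero_of_lt_order
    rw [Finset.mem_range] at h
    omega

theorem polyPart_eq_of_orderTop_pos {α : LaurentSeries K} {p : Polynomial K}
    (h : 0 < (α - emb p).orderTop) : polyPart α = p := by
  ext i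
  have h0 := HahnSeries.coeff_eq_zero_of_lt_orderTop (x := α - emb p) (i := -(i : ℤ))
    (lt_of_le_of_lt (by exact_mod_cast (by omega : -(i : ℤ) ≤ 0)) h)
  rw [HahnSeries.coeff_sub, coeff_emb, if_pos (by omega), sub_eq_zero] at h0
  rw [coeff_polyPart, h0]
  simp

theorem orderTop_sub_emb_polyPart_pos (α : LaurentSeries K) :
    0 < (α - emb (polyPart α)).orderTop := by
  refine lt_of_lt_of_le (by exact_mod_cast zero_lt_one : (0 : WithTop ℤ) < ((1 : ℤ) : WithTop ℤ)) ?_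
  rw [HahnSeries.le_orderTop_iff_forall]
  intro j hj
  rw [WithTop.coe_lt_coe] at hj
  rw [HahnSeries.coeff_sub, coeff_emb, if_pos (by omega), coeff_polyPart, Int.toNat_of_nonneg (by omega)]
  simp

@[simp] theorem polyPart_zero : polyPart (0 : LaurentSeries K) = 0 :=
  polyPart_eq_of_orderTop_pos (by simp)

theorem natDegree_polyPart_pos {α : LaurentSeries K} (h : α.orderTop < 0) :
    0 < (polyPart α).natDegree := by
  have h1 := orderTop_sub_emb_polyPart_pos α
  have h2 : (emb (polyPart α)).orderTop = α.orderTop := by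
    have := HahnSeries.orderTop_sub (h.trans h1)
    rwa [sub_sub_cancel] at this
  have hp : polyPart α ≠ 0 := by
    intro hp
    rw [hp, map_zero, HahnSeries.orderTop_zero] at h2
    rw [← h2] at h
    exact not_top_lt h
  rw [← h2, orderTop_emb hp] at h
  norm_cast at h
  omega

theorem cq_ne_zero_of_le {α : LaurentSeries K} {i n : ℕ} (hi : i ≤ n) (h : cq α n ≠ 0) :
    cq α i ≠ 0 := by
  induction n, hi using Nat.le_induction with
  | base => exact h
  | succ n _ ih => exact ih fun h0 => h (by simp [cq, h0])

theorem natDegree_pq_pos {α : LaurentSeries K} {i : ℕ} (hi : 1 ≤ i) (h : cq α i ≠ 0) :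
    0 < (pq α i).natDegree := by
  obtain ⟨i, rfl⟩ := Nat.exists_eq_add_of_le' hi
  apply natDegree_polyPart_pos
  have hx : cq α i - emb (polyPart (cq α i)) ≠ 0 := fun h0 => h (by simp [cq, h0])
  have hpos := orderTop_sub_emb_polyPart_pos (cq α i)
  have ho := (HahnSeries.order_eq_orderTop_of_ne_zero hx).symm
  rw [cq, orderTop_inv ho]
  rw [ho] at hpos
  norm_cast at hpos ⊢
  omega

theorem cfTrunc_zero (s : ℕ → Polynomial K) : cfTrunc s 0 = emb (s 0) := by
  simp [cfTrunc, cfEval]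

theorem cfTrunc_succ (s : ℕ → Polynomial K) (m : ℕ) :
    cfTrunc s (m + 1) = emb (s 0) + (cfTrunc (fun i => s (i + 1)) m)⁻¹ := by
  rw [cfTrunc, List.range_succ_eq_map, List.map_cons, List.map_map]
  rfl

theorem orderTop_emb_add_inv {p : Polynomial K} (hp : p ≠ 0) {x : LaurentSeries K} {d : ℕ}
    (hx : x.orderTop = ((-(d : ℤ) : ℤ) : WithTop ℤ)) (hd : 0 < p.natDegree + d) :
    (emb p + x⁻¹).orderTop = ((-(p.natDegree : ℤ) : ℤ) : WithTop ℤ) := by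
  rw [HahnSeries.orderTop_add_eq_left, orderTop_emb hp]
  rw [orderTop_emb hp, orderTop_inv hx]
  norm_cast
  omega

/-- A continued fraction expansion of `ξ 0` with partial quotients `s i` and complete quotients
`ξ i`: constant partial quotients are nonzero and never adjacent, and each complete quotient has
the order of its leading partial quotient. -/
structure IsCFExpansion (s : ℕ → Polynomial K) (ξ : ℕ → LaurentSeries K) : Prop where
  ne_zero : ∀ i, s i ≠ 0
  degree_pos : ∀ i, 0 < (s i).natDegree + (s (i + 1)).natDegree
  orderTop_eq : ∀ i, (ξ i).orderTop = ((-((s i).natDegree : ℤ) : ℤ) : WithTop ℤ)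
  eq_add_inv : ∀ i, ξ i = emb (s i) + (ξ (i + 1))⁻¹

namespace IsCFExpansion

variable {s : ℕ → Polynomial K} {ξ : ℕ → LaurentSeries K}

theorem shift (h : IsCFExpansion s ξ) :
    IsCFExpansion (fun i => s (i + 1)) (fun i => ξ (i + 1)) :=
  ⟨fun _ => h.ne_zero _, fun _ => h.degree_pos _, fun _ => h.orderTop_eq _,
    fun _ => h.eq_add_inv _⟩

theorem apply_ne_zero (h : IsCFExpansion s ξ) (i : ℕ) : ξ i ≠ 0 :=
  ne_zero_of_orderTop_eq_coe (h.orderTop_eq i)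

theorem orderTop_cfTrunc (h : IsCFExpansion s ξ) (m : ℕ) :
    (cfTrunc s m).orderTop = ((-((s 0).natDegree : ℤ) : ℤ) : WithTop ℤ) := by
  induction m generalizing s ξ with
  | zero => rw [cfTrunc_zero, orderTop_emb (h.ne_zero 0)]
  | succ m ih =>
    rw [cfTrunc_succ]
    exact orderTop_emb_add_inv (h.ne_zero 0) (ih h.shift) (h.degree_pos 0)

theorem le_orderTop_sub_cfTrunc (h : IsCFExpansion s ξ) (m : ℕ) :
    (((m : ℤ) - (s 0).natDegree : ℤ) : WithTop ℤ) ≤ (ξ 0 - cfTrunc s m).orderTop := by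
  induction m generalizing s ξ with
  | zero =>
    rw [cfTrunc_zero, h.eq_add_inv 0, add_sub_cancel_left, orderTop_inv (h.orderTop_eq 1),
      WithTop.coe_le_coe]
    push_cast
    omega
  | succ m ih =>
    have ht := h.shift.orderTop_cfTrunc m
    have ih := ih h.shift
    have hd := h.degree_pos 0
    have hξ := h.apply_ne_zero 1
    rw [cfTrunc_succ, h.eq_add_inv 0]
    simp only [zero_add] at *
    set τ := cfTrunc (fun i => s (i + 1)) m
    have hτ0 : τ ≠ 0 := ne_zero_of_orderTop_eq_coe ht
    have key : emb (s 0) + (ξ 1)⁻¹ - (emb (s 0) + τ⁻¹) = -((ξ 1 - τ) * ((ξ 1)⁻¹ * τ⁻¹)) := by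
      field_simp
      ring
    rw [key, HahnSeries.orderTop_neg, HahnSeries.orderTop_mul, HahnSeries.orderTop_mul,
      orderTop_inv ht, orderTop_inv (h.orderTop_eq 1)]
    refine le_trans ?_ (add_le_add_left ih _)
    rw [← WithTop.coe_add, ← WithTop.coe_add, WithTop.coe_le_coe]
    push_cast
    omega

theorem orderTop_affine (h : IsCFExpansion s ξ) {i : ℕ} (hi : 0 < (s i).natDegree) {u : K}
    (hu : u ≠ 0) (v : K) :
    (emb (Polynomial.C u) * ξ i + emb (Polynomial.C v)).orderTop =
      ((-((s i).natDegree : ℤ) : ℤ) : WithTop ℤ) := by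
  have h1 : (emb (Polynomial.C u) * ξ i).orderTop =
      ((-((s i).natDegree : ℤ) : ℤ) : WithTop ℤ) := by
    rw [HahnSeries.orderTop_mul, orderTop_emb (Polynomial.C_ne_zero.2 hu), h.orderTop_eq]
    simp
  rw [HahnSeries.orderTop_add_eq_left, h1]
  rw [h1]
  refine lt_of_lt_of_le ?_ (orderTop_emb_C_nonneg v)
  norm_cast
  omega

/-- The step of the regular continued fraction algorithm applied to an affine image of `ξ i`:
a constant partial quotient `s (i + 1)` gets absorbed. -/
theorem exists_step (h : IsCFExpansion s ξ) (i : ℕ) {u : K} (hu : u ≠ 0) (v : K) :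
    ∃ (w : K) (j : ℕ) (u' v' : K), u' ≠ 0 ∧
      polyPart (emb (Polynomial.C u) * ξ i + emb (Polynomial.C v)) =
        Polynomial.C u * s i + Polynomial.C w ∧
      (emb (Polynomial.C u) * ξ i + emb (Polynomial.C v) -
        emb (Polynomial.C u * s i + Polynomial.C w))⁻¹ =
        emb (Polynomial.C u') * ξ j + emb (Polynomial.C v') := by
  suffices H : ∃ (w : K) (j : ℕ) (u' v' : K), 0 < (s j).natDegree ∧ u' ≠ 0 ∧
      emb (Polynomial.C u) * ξ i + emb (Polynomial.C v) -
        emb (Polynomial.C u * s i + Polynomial.C w) =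
        (emb (Polynomial.C u') * ξ j + emb (Polynomial.C v'))⁻¹ by
    obtain ⟨w, j, u', v', hj, hu', H⟩ := H
    refine ⟨w, j, u', v', hu', polyPart_eq_of_orderTop_pos ?_, by rw [H, inv_inv]⟩
    rw [H, orderTop_inv (h.orderTop_affine hj hu' v')]
    norm_cast
    omega
  have hU : emb (Polynomial.C u) ≠ 0 := emb_ne_zero (Polynomial.C_ne_zero.2 hu)
  have inv_C : ∀ c : K, emb (Polynomial.C c⁻¹) = (emb (Polynomial.C c))⁻¹ := fun c =>
    map_inv₀ (emb.comp Polynomial.C) c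
  by_cases hs : (s (i + 1)).natDegree = 0
  · obtain ⟨c, hc⟩ := Polynomial.natDegree_eq_zero.1 hs
    have hc0 : c ≠ 0 := by
      rintro rfl
      exact h.ne_zero (i + 1) (by simp [← hc])
    have hs2 : 0 < (s (i + 2)).natDegree := by simpa [hs] using h.degree_pos (i + 1)
    have hC : emb (Polynomial.C c) ≠ 0 := emb_ne_zero (Polynomial.C_ne_zero.2 hc0)
    refine ⟨v + u * c⁻¹, i + 2, -(c * c * u⁻¹), -(c * u⁻¹), hs2, by simp [hc0, hu], ?_⟩
    have hξ := h.apply_ne_zero (i + 2)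
    have hstep := h.eq_add_inv (i + 1)
    rw [← hc] at hstep
    have hden := ne_zero_of_orderTop_eq_coe (h.orderTop_affine hs2 hc0 1)
    have hquot : ξ (i + 1) =
        (emb (Polynomial.C c) * ξ (i + 2) + emb (Polynomial.C 1)) / ξ (i + 2) := by
      rw [hstep]
      simp
      field_simp
    rw [h.eq_add_inv i, hquot]
    simp only [map_add, map_mul, map_neg, inv_C, map_one] at hden ⊢
    have hneg : -(emb (Polynomial.C c) * emb (Polynomial.C c) * (emb (Polynomial.C u))⁻¹) * ξ (i + 2)
        + -(emb (Polynomial.C c) * (emb (Polynomial.C u))⁻¹) =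
        -(emb (Polynomial.C c) * (emb (Polynomial.C u))⁻¹ *
          (emb (Polynomial.C c) * ξ (i + 2) + 1)) := by ring
    rw [hneg]
    field_simp
    ring
  · refine ⟨v, i + 1, u⁻¹, 0, Nat.pos_of_ne_zero hs, inv_ne_zero hu, ?_⟩
    rw [h.eq_add_inv i]
    simp only [map_add, map_mul, map_zero, inv_C]
    rw [add_zero, mul_inv, inv_inv]
    ring

/-- Every complete quotient of the regular expansion of `ξ 0`, from the first on, is an affine
image of some `ξ i`. -/
theorem exists_cq_eq (h : IsCFExpansion s ξ) (h0 : (s 0).natDegree = 0) (N : ℕ) :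
    ∃ (i : ℕ) (u v : K), u ≠ 0 ∧
      cq (ξ 0) (N + 1) = emb (Polynomial.C u) * ξ i + emb (Polynomial.C v) := by
  induction N with
  | zero =>
    have h1 : 0 < (s 1).natDegree := by simpa [h0] using h.degree_pos 0
    have hp : polyPart (ξ 0) = s 0 := by
      apply polyPart_eq_of_orderTop_pos
      rw [h.eq_add_inv 0, add_sub_cancel_left, orderTop_inv (h.orderTop_eq 1)]
      norm_cast
      omega
    refine ⟨1, 1, 0, one_ne_zero, ?_⟩
    rw [cq, cq, hp]
    nth_rw 1 [h.eq_add_inv 0]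
    simp
  | succ N ih =>
    obtain ⟨i, u, v, hu, hN⟩ := ih
    obtain ⟨w, j, u', v', hu', hp, hc⟩ := h.exists_step i hu v
    exact ⟨j, u', v', hu', by rw [cq, hN, hp, hc]⟩

theorem KK_le (h : IsCFExpansion s ξ) (h0 : (s 0).natDegree = 0) {B : ℕ∞}
    (hB : ∀ i, ((s i).natDegree : ℕ∞) ≤ B) : KK (ξ 0) ≤ B := by
  refine iSup_le ?_
  rintro ⟨N, hN, -⟩
  obtain ⟨N, rfl⟩ := Nat.exists_eq_add_of_le' hN
  obtain ⟨i, u, v, hu, hcq⟩ := h.exists_cq_eq h0 N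
  obtain ⟨w, -, -, -, -, hp, -⟩ := h.exists_step i hu v
  refine le_of_eq_of_le ?_ (hB i)
  rw [pq, hcq, hp, Polynomial.natDegree_add_C, Polynomial.natDegree_C_mul hu]

theorem exists_lt_orderTop_sub_cfTrunc (h : IsCFExpansion s ξ) (M : ℤ) :
    ∃ N : ℕ, ∀ m : ℕ, N ≤ m →
      ξ 0 - cfTrunc s m = 0 ∨ M < (ξ 0 - cfTrunc s m).order := by
  refine ⟨(M + (s 0).natDegree + 1).toNat, fun m hm => or_iff_not_imp_left.2 fun h0 => ?_⟩
  have := h.le_orderTop_sub_cfTrunc m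
  rw [← HahnSeries.order_eq_orderTop_of_ne_zero h0, WithTop.coe_le_coe] at this
  omega

end IsCFExpansion

/-- The value `[b (N - j), …, b (N - 1), x]`. -/
def cfTail (b : ℕ → Polynomial K) (N : ℕ) (x : LaurentSeries K) : ℕ → LaurentSeries K
  | 0 => x
  | j + 1 => emb (b (N - 1 - j)) + (cfTail b N x j)⁻¹

section Periodic

variable {b : ℕ → Polynomial K} {N : ℕ} {x : LaurentSeries K}

theorem orderTop_cfTail (hb : ∀ i < N, b i ≠ 0)
    (hd : ∀ i < N, 0 < (b i).natDegree + (b ((i + 1) % N)).natDegree)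
    (hx : x.orderTop = ((-((b 0).natDegree : ℤ) : ℤ) : WithTop ℤ)) {j : ℕ} (hj : j ≤ N) :
    (cfTail b N x j).orderTop =
      ((-((b ((N - j) % N)).natDegree : ℤ) : ℤ) : WithTop ℤ) := by
  induction j with
  | zero => simpa [cfTail] using hx
  | succ j ih =>
    have h1 := hd (N - 1 - j) (by omega)
    rw [show N - 1 - j + 1 = N - j by omega] at h1
    rw [Nat.mod_eq_of_lt (by omega : N - (j + 1) < N), show N - (j + 1) = N - 1 - j by omega]
    exact orderTop_emb_add_inv (hb _ (by omega)) (ih (by omega)) h1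

theorem isCFExpansion_of_periodic (hN : 0 < N) (hb : ∀ i < N, b i ≠ 0)
    (hd : ∀ i < N, 0 < (b i).natDegree + (b ((i + 1) % N)).natDegree)
    (hx : x.orderTop = ((-((b 0).natDegree : ℤ) : ℤ) : WithTop ℤ))
    (hper : cfTail b N x N = x) :
    IsCFExpansion (fun i => b (i % N)) (fun i => cfTail b N x (N - i % N)) where
  ne_zero i := hb _ (Nat.mod_lt _ hN)
  degree_pos i := by
    simpa using hd (i % N) (Nat.mod_lt _ hN)
  orderTop_eq i := by
    have hi := Nat.mod_lt i hN
    have := orderTop_cfTail hb hd hx (j := N - i % N) (by omega)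
    rwa [show N - (N - i % N) = i % N by omega, Nat.mod_mod] at this
  eq_add_inv i := by
    have hi := Nat.mod_lt i hN
    have h1 : cfTail b N x (N - (i + 1) % N) = cfTail b N x (N - 1 - i % N) := by
      rw [Nat.add_mod_eq_ite]
      rcases Nat.lt_or_ge (i % N + 1) N with h | h
      · rw [Nat.mod_eq_of_lt (by omega : 1 < N), if_neg (by omega)]
        congr 1
        omega
      · have : N = i % N + 1 := by omega
        rcases eq_or_ne N 1 with rfl | hN1
        · simp [Nat.mod_one, hper, cfTail]
        · rw [Nat.mod_eq_of_lt (by omega : 1 < N), if_pos (by omega),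
            show N - (i % N + 1 - N) = N by omega, show N - 1 - i % N = 0 by omega, hper]
          rfl
    obtain ⟨j, hj⟩ : ∃ j, N - i % N = j + 1 := ⟨N - i % N - 1, by omega⟩
    rw [h1, hj, cfTail, show N - 1 - j = i % N by omega, show N - 1 - i % N = j by omega]

end Periodic

/-- The continuants `(pₙ, qₙ)` with index shifted by one, so as to start from `(p₋₁, q₋₁)`. -/
def shiftCont (α : LaurentSeries K) : ℕ → Polynomial K × Polynomial K
  | 0 => (1, 0)
  | n + 1 => cont α n

theorem shiftCont_add_two (α : LaurentSeries K) (i : ℕ) :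
    (shiftCont α (i + 2)).1 = pq α (i + 1) * (shiftCont α (i + 1)).1 + (shiftCont α i).1 ∧
    (shiftCont α (i + 2)).2 = pq α (i + 1) * (shiftCont α (i + 1)).2 + (shiftCont α i).2 := by
  cases i <;> simp [shiftCont, cont]

theorem shiftCont_det (α : LaurentSeries K) (i : ℕ) :
    (shiftCont α (i + 1)).1 * (shiftCont α i).2 - (shiftCont α i).1 * (shiftCont α (i + 1)).2 =
      (-1) ^ (i + 1) := by
  induction i with
  | zero => simp [shiftCont, cont]
  | succ i ih =>
    rw [(shiftCont_add_two α i).1, (shiftCont_add_two α i).2, pow_succ, ← ih]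
    ring

section Mercat

variable {a : ℕ → Polynomial K} {n : ℕ} {t k : K}

theorem mercatBlock_zero : mercatBlock a n t k 0 = Polynomial.C (2 * k⁻¹) := if_pos rfl

theorem mercatBlock_of_le {i : ℕ} (h0 : 1 ≤ i) (hi : i ≤ n) :
    mercatBlock a n t k i = -a i := by
  rw [mercatBlock, if_neg (by omega), if_pos hi]

theorem mercatBlock_middle :
    mercatBlock a n t k (n + 1) = Polynomial.C ((-1) ^ (n + 1) * 2 * t * k⁻¹) := by
  rw [mercatBlock, if_neg (by omega), if_neg (by omega), if_pos rfl]

theorem mercatBlock_of_gt {i : ℕ} (hi : n + 2 ≤ i) :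
    mercatBlock a n t k i = a (2 * n + 2 - i) := by
  rw [mercatBlock, if_neg (by omega), if_neg (by omega), if_neg (by omega)]

theorem mercatBlock_cases {i : ℕ} (hi : i < 2 * n + 2) :
    ((i = 0 ∨ i = n + 1) ∧ (mercatBlock a n t k i).natDegree = 0) ∨
      ∃ j, 1 ≤ j ∧ j ≤ n ∧ i ≠ 0 ∧ i ≠ n + 1 ∧
        (mercatBlock a n t k i).natDegree = (a j).natDegree := by
  rcases Nat.eq_zero_or_pos i with rfl | h0
  · left
    simp [mercatBlock_zero, -map_mul]
  rcases Nat.lt_trichotomy i (n + 1) with h | rfl | h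
  · exact Or.inr ⟨i, h0, by omega, by omega, by omega,
      by rw [mercatBlock_of_le h0 (by omega), Polynomial.natDegree_neg]⟩
  · left
    rw [mercatBlock_middle]
    exact ⟨Or.inr rfl, Polynomial.natDegree_C _⟩
  · exact Or.inr ⟨2 * n + 2 - i, by omega, by omega, by omega, by omega,
      by rw [mercatBlock_of_gt (by omega)]⟩

theorem mercatBlock_ne_zero (h2 : (2 : K) ≠ 0) (ht : t ≠ 0) (hk : k ≠ 0)
    (ha : ∀ j, 1 ≤ j → j ≤ n → 0 < (a j).natDegree) {i : ℕ} (hi : i < 2 * n + 2) :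
    mercatBlock a n t k i ≠ 0 := by
  rcases mercatBlock_cases (a := a) (t := t) (k := k) hi with ⟨rfl | rfl, -⟩ | ⟨j, h1, hj, -, -, h⟩
  · rw [mercatBlock_zero, Polynomial.C_ne_zero]
    exact mul_ne_zero h2 (inv_ne_zero hk)
  · rw [mercatBlock_middle, Polynomial.C_ne_zero]
    exact mul_ne_zero (mul_ne_zero (mul_ne_zero (by simp) h2) ht) (inv_ne_zero hk)
  · intro h0
    have := ha j h1 hj
    rw [← h, h0] at this
    simp at this

theorem mercatBlock_degree_pos (hn : 1 ≤ n)
    (ha : ∀ j, 1 ≤ j → j ≤ n → 0 < (a j).natDegree) {i : ℕ} (hi : i < 2 * n + 2) :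
    0 < (mercatBlock a n t k i).natDegree +
      (mercatBlock a n t k ((i + 1) % (2 * n + 2))).natDegree := by
  rcases mercatBlock_cases (a := a) (t := t) (k := k) hi with ⟨h0, -⟩ | ⟨j, h1, hj, -, -, h⟩
  · rw [Nat.mod_eq_of_lt (by omega)]
    rcases mercatBlock_cases (a := a) (t := t) (k := k) (by omega : i + 1 < 2 * n + 2) with
      ⟨h, -⟩ | ⟨j, h1, hj, -, -, h⟩
    · omega
    · rw [h]
      have := ha j h1 hj
      omega
  · rw [h]
    have := ha j h1 hj
    omega

end Mercat

/-- The block in Mercat's expansion fixes `x`, where `e` and `e'` stand for `X ± Y√D`. -/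
theorem cfTail_mercatBlock_eq {α x e e' : LaurentSeries K} {X Z : Polynomial K} {n : ℕ} {t k : K}
    (h0 : pq α 0 = 0) (hk : k ≠ 0) (ht : t ^ 2 = 1)
    (hP : contP α n = Polynomial.C k * Z) (hQ : contQ α n = Polynomial.C k * X)
    (hX : X ≠ 0) (hsum : e + e' = 2 * emb X) (hprod : e * e' = emb (Polynomial.C t))
    (hx : emb (Polynomial.C k) * emb X * x = e - emb (Polynomial.C k) * emb Z)
    (hne : ∀ j ≤ 2 * n + 2,
      cfTail (mercatBlock (pq α) n t k) (2 * n + 2) x j ≠ 0) :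
    cfTail (mercatBlock (pq α) n t k) (2 * n + 2) x (2 * n + 2) = x := by
  set b := mercatBlock (pq α) n t k with hb
  set P : ℕ → LaurentSeries K := fun i => emb (shiftCont α i).1
  set Q : ℕ → LaurentSeries K := fun i => emb (shiftCont α i).2
  have hP0 : P 0 = 1 := by simp [P, shiftCont]
  have hQ0 : Q 0 = 0 := by simp [Q, shiftCont]
  have hP1 : P 1 = 0 := by simp [P, shiftCont, cont, h0]
  have hQ1 : Q 1 = 1 := by simp [Q, shiftCont, cont]
  have hPs : ∀ i, P (i + 2) = emb (pq α (i + 1)) * P (i + 1) + P i := fun i => by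
    simp only [P, (shiftCont_add_two α i).1, map_add, map_mul]
  have hQs : ∀ i, Q (i + 2) = emb (pq α (i + 1)) * Q (i + 1) + Q i := fun i => by
    simp only [Q, (shiftCont_add_two α i).2, map_add, map_mul]
  have hdet : P (n + 1) * Q n - P n * Q (n + 1) = (-1) ^ (n + 1) := by
    simpa using congrArg emb (shiftCont_det α n)
  have hPn : P (n + 1) = emb (Polynomial.C k) * emb Z := by
    rw [← map_mul, ← hP]; rfl
  have hQn : Q (n + 1) = emb (Polynomial.C k) * emb X := by
    rw [← map_mul, ← hQ]; rfl
  set κ := emb (Polynomial.C k) with hκ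
  set τ := emb (Polynomial.C t) with hτ
  have hκ0 : κ ≠ 0 := emb_ne_zero (Polynomial.C_ne_zero.2 hk)
  have hX0 : emb X ≠ 0 := emb_ne_zero hX
  have hτ2 : τ ^ 2 = 1 := by rw [hτ, ← map_pow, ← map_pow, ht]; simp
  have hκinv : emb (Polynomial.C k⁻¹) = κ⁻¹ := map_inv₀ (emb.comp Polynomial.C) k
  have he : e ≠ 0 := by
    rintro rfl
    rw [zero_mul] at hprod
    simp [← hprod] at hτ2
  have hrev : ∀ j ≤ n, cfTail b (2 * n + 2) x j * (Q j * x + P j) = Q (j + 1) * x + P (j + 1) := by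
    intro j hj
    induction j with
    | zero => simp [cfTail, hP0, hQ0, hP1, hQ1]
    | succ j ih =>
      have ih := ih (by omega)
      have hn0 := hne j (by omega)
      rw [cfTail, hb, mercatBlock_of_gt (by omega), ← hb,
        show 2 * n + 2 - (2 * n + 2 - 1 - j) = j + 1 by omega, add_mul]
      nth_rw 2 [← ih]
      rw [inv_mul_cancel_left₀ hn0, hPs, hQs]
      ring
  have hw : cfTail b (2 * n + 2) x n * (Q n * x + P n) = e := by
    rw [hrev n le_rfl, hPn, hQn, hx]
    ring
  set θ := 2 * κ⁻¹ - x with hθ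
  have hkc : emb (b (n + 1)) * κ = (-1) ^ (n + 1) * 2 * τ := by
    rw [hb, mercatBlock_middle]
    simp only [map_mul, map_pow, map_neg, map_one, map_ofNat, hκinv, ← hτ]
    field_simp
  have hXθ : κ * emb X * θ = e' + κ * emb Z := by
    rw [hθ, mul_sub, hx]
    field_simp
    linear_combination -hsum
  have hmid : cfTail b (2 * n + 2) x (n + 1) * (Q (n + 1) * θ - P (n + 1)) = Q n * θ - P n := by
    have hη : e * cfTail b (2 * n + 2) x (n + 1) = emb (b (n + 1)) * e + (Q n * x + P n) := by
      have hn0 := hne n (by omega)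
      rw [cfTail, show 2 * n + 2 - 1 - n = n + 1 by omega, mul_add]
      nth_rw 2 [← hw]
      field_simp
    rw [hPn, hQn] at hdet
    rw [hPn, hQn, hXθ, add_sub_cancel_right]
    apply mul_left_cancel₀ (mul_ne_zero he (mul_ne_zero hκ0 hX0))
    linear_combination κ * emb X * e' * hη + e' * Q n * hx - e * Q n * hXθ - (e + e') * hdet
      + emb X * e * e' * hkc + 2 * (-1) ^ (n + 1) * τ * emb X * hprod
      + 2 * (-1) ^ (n + 1) * emb X * hτ2 - (-1) ^ (n + 1) * hsum
  have hfwd : ∀ j ≤ n, cfTail b (2 * n + 2) x (n + 1 + j) *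
      (Q (n + 1 - j) * θ - P (n + 1 - j)) = Q (n - j) * θ - P (n - j) := by
    intro j hj
    induction j with
    | zero => simpa using hmid
    | succ j ih =>
      have ih := ih (by omega)
      have hn0 := hne (n + 1 + j) (by omega)
      obtain ⟨i, hi⟩ : ∃ i, n - j = i + 1 := ⟨n - j - 1, by omega⟩
      rw [show n + 1 - j = i + 2 by omega, hi, hPs, hQs] at ih
      rw [← add_assoc, cfTail, hb, mercatBlock_of_le (by omega) (by omega), ← hb,
        show 2 * n + 2 - 1 - (n + 1 + j) = i + 1 by omega,
        show n + 1 - (j + 1) = i + 1 by omega, show n - (j + 1) = i by omega, add_mul]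
      nth_rw 2 [← ih]
      rw [inv_mul_cancel_left₀ hn0, map_neg]
      ring
  have hlast := hfwd n le_rfl
  rw [show n + 1 - n = 1 by omega, Nat.sub_self, hP0, hQ0, hP1, hQ1] at hlast
  have hlast' : (cfTail b (2 * n + 2) x (n + 1 + n))⁻¹ = -θ := by
    rw [inv_eq_iff_eq_inv]
    exact eq_inv_of_mul_eq_one_left (by linear_combination -hlast)
  rw [show 2 * n + 2 = n + 1 + n + 1 by omega, cfTail,
    show n + 1 + n + 1 - 1 - (n + 1 + n) = 0 by omega,
    show n + 1 + n + 1 = 2 * n + 2 by omega, hlast', hb, mercatBlock_zero, hθ]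
  have h2 : emb (Polynomial.C (2 : K)) = 2 := map_ofNat (emb.comp Polynomial.C) 2
  rw [map_mul, map_mul, hκinv, h2]
  ring

end PaperCF

open PaperCF in
/-- **polynomial analogue of Mercat's theorem.** With `(X, Y)` a
non-trivial solution of the Pell equation for `D` (`X² − DY² = t ∈ {±1}`, sign of `Y`
chosen so that `ord(X + Y√D) < 0`), `Z` coprime to `X` with `deg Z < deg X`,
`Z/X = [0, a₁, …, aₙ]` and `k` the constant with `pₙ = kZ`, `qₙ = kX`: the infinite
periodic continued fraction with repeating block
`(2/k, −a₁, …, −aₙ, (−1)^{n+1}·2t/k, aₙ, …, a₁)` converges in `K((T⁻¹))` to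
`β' = (X − kZ + Y√D)/(kX)`; in particular `K(β') ≤ K(Z/X)`. -/
theorem mercat_periodic_cf {K : Type*} [Field K]
    (hchar : ringChar K ≠ 2) (D : Polynomial K)
    (hDeven : Even D.natDegree) (hDpos : 0 < D.natDegree)
    (hDnsq : ¬ IsSquare D) (hDlead : IsSquare D.leadingCoeff)
    (β : LaurentSeries K) (hβ : β ^ 2 = emb D)
    (X Y : Polynomial K) (t : K) (ht : t = 1 ∨ t = -1) (hY : Y ≠ 0)
    (hPell : X ^ 2 - D * Y ^ 2 = Polynomial.C t)
    (hord : (emb X + emb Y * β).order < 0)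
    (Z : Polynomial K) (hZX : IsCoprime Z X) (hZdeg : Z.natDegree < X.natDegree)
    (n : ℕ) (hn : cq (emb Z / emb X) n ≠ 0) (hn' : cq (emb Z / emb X) (n + 1) = 0)
    (k : K) (hk : k ≠ 0)
    (hPn : contP (emb Z / emb X) n = Polynomial.C k * Z)
    (hQn : contQ (emb Z / emb X) n = Polynomial.C k * X) :
    (∀ M : ℤ, ∃ N : ℕ, ∀ m : ℕ, N ≤ m →
      (emb X - emb (Polynomial.C k * Z) + emb Y * β) / emb (Polynomial.C k * X)
          - cfTrunc (fun i => mercatBlock (pq (emb Z / emb X)) n t k (i % (2 * n + 2))) m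
        = 0 ∨
      M < ((emb X - emb (Polynomial.C k * Z) + emb Y * β) / emb (Polynomial.C k * X)
          - cfTrunc (fun i => mercatBlock (pq (emb Z / emb X)) n t k (i % (2 * n + 2))) m
        ).order) ∧
    KK ((emb X - emb (Polynomial.C k * Z) + emb Y * β) / emb (Polynomial.C k * X))
      ≤ KK (emb Z / emb X) := by
  have h2 : (2 : K) ≠ 0 := Ring.two_ne_zero hchar
  have ht2 : t ^ 2 = 1 := by rcases ht with rfl | rfl <;> simp
  have ht0 : t ≠ 0 := by rintro rfl; simp at ht2
  have hXdeg : 0 < X.natDegree := by omega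
  have hX : X ≠ 0 := by rintro rfl; simp at hXdeg
  have hkX : emb (Polynomial.C k * X) ≠ 0 :=
    emb_ne_zero (mul_ne_zero (Polynomial.C_ne_zero.2 hk) hX)
  set α := emb Z / emb X with hα
  set x := (emb X - emb (Polynomial.C k * Z) + emb Y * β) / emb (Polynomial.C k * X) with hxdef
  have hpq0 : pq α 0 = 0 := by
    apply polyPart_eq_of_orderTop_pos
    rw [map_zero, sub_zero, cq, hα, div_eq_mul_inv, HahnSeries.orderTop_mul,
      orderTop_inv (orderTop_emb hX)]
    rcases eq_or_ne Z 0 with rfl | hZ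
    · simp
    · rw [orderTop_emb hZ, ← WithTop.coe_add]
      norm_cast
      omega
  have hn1 : 1 ≤ n := by
    rcases Nat.eq_zero_or_pos n with rfl | h
    · have := congrArg Polynomial.natDegree hQn
      rw [Polynomial.natDegree_C_mul hk] at this
      simp [contQ, cont] at this
      omega
    · exact h
  have ha : ∀ j, 1 ≤ j → j ≤ n → 0 < (pq α j).natDegree := fun j h1 hj =>
    natDegree_pq_pos h1 (cq_ne_zero_of_le hj hn)
  set e := emb X + emb Y * β with he
  set e' := emb X - emb Y * β with he'
  have hsum : e + e' = 2 * emb X := by rw [he, he']; ring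
  have hprod : e * e' = emb (Polynomial.C t) := by
    rw [← hPell, map_sub, map_mul, map_pow, map_pow, ← hβ, he, he']
    ring
  have hx : emb (Polynomial.C k) * emb X * x = e - emb (Polynomial.C k) * emb Z := by
    rw [hxdef, ← map_mul, mul_div_cancel₀ _ hkX, map_mul]
    ring
  have hconj_pos : 0 < e'.orderTop := by
    have he0 : e ≠ 0 := by
      intro h
      simp [h] at hord
    have h1 := congrArg HahnSeries.orderTop hprod
    rw [HahnSeries.orderTop_mul, orderTop_emb (Polynomial.C_ne_zero.2 ht0),
      ← HahnSeries.order_eq_orderTop_of_ne_zero he0] at h1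
    have he'0 : e' ≠ 0 := by
      intro h
      rw [h, mul_zero] at hprod
      exact emb_ne_zero (Polynomial.C_ne_zero.2 ht0) hprod.symm
    rw [← HahnSeries.order_eq_orderTop_of_ne_zero he'0] at h1 ⊢
    rw [Polynomial.natDegree_C] at h1
    norm_cast at h1 ⊢
    omega
  have hxtop : x.orderTop =
      ((-((mercatBlock (pq α) n t k 0).natDegree : ℤ) : ℤ) : WithTop ℤ) := by
    have hκinv : emb (Polynomial.C k⁻¹) = (emb (Polynomial.C k))⁻¹ :=
      map_inv₀ (emb.comp Polynomial.C) k
    have hC2 : emb (Polynomial.C (2 : K)) = 2 := map_ofNat (emb.comp Polynomial.C) 2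
    have hkX' : emb (Polynomial.C k) * emb X ≠ 0 := by rwa [← map_mul]
    have hk0 := left_ne_zero_of_mul hkX'
    have hX0 := right_ne_zero_of_mul hkX'
    have hsplit : x = emb (Polynomial.C (2 * k⁻¹)) -
        (e' + emb (Polynomial.C k * Z)) * (emb (Polynomial.C k * X))⁻¹ := by
      apply mul_left_cancel₀ hkX'
      simp only [map_mul, hC2, hκinv]
      rw [hx]
      field_simp
      linear_combination hsum
    have hCX : (emb (Polynomial.C k * X)).orderTop = ((-(X.natDegree : ℤ) : ℤ) : WithTop ℤ) := by
      rw [orderTop_emb (mul_ne_zero (Polynomial.C_ne_zero.2 hk) hX), Polynomial.natDegree_C_mul hk]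
    have hsmall : 0 <
        ((e' + emb (Polynomial.C k * Z)) * (emb (Polynomial.C k * X))⁻¹).orderTop := by
      refine orderTop_mul_inv_pos hCX
        (lt_of_lt_of_le (lt_min ?_ ?_) HahnSeries.min_orderTop_le_orderTop_add)
      · exact lt_trans (by norm_cast; omega) hconj_pos
      · rcases eq_or_ne Z 0 with rfl | hZ
        · rw [mul_zero, map_zero, HahnSeries.orderTop_zero]
          exact WithTop.coe_lt_top _
        · rw [orderTop_emb (mul_ne_zero (Polynomial.C_ne_zero.2 hk) hZ),
            Polynomial.natDegree_C_mul hk]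
          norm_cast
          omega
    have hc : (emb (Polynomial.C (2 * k⁻¹))).orderTop = 0 := by
      rw [orderTop_emb (Polynomial.C_ne_zero.2 (mul_ne_zero h2 (inv_ne_zero hk))),
        Polynomial.natDegree_C]
      simp
    rw [hsplit, HahnSeries.orderTop_sub (by rwa [hc]), hc, mercatBlock_zero, Polynomial.natDegree_C]
    simp
  have hb : ∀ i < 2 * n + 2, mercatBlock (pq α) n t k i ≠ 0 := fun i hi =>
    mercatBlock_ne_zero h2 ht0 hk ha hi
  have hd : ∀ i < 2 * n + 2, 0 < (mercatBlock (pq α) n t k i).natDegree +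
      (mercatBlock (pq α) n t k ((i + 1) % (2 * n + 2))).natDegree := fun i hi =>
    mercatBlock_degree_pos hn1 ha hi
  have hper := cfTail_mercatBlock_eq hpq0 hk ht2 hPn hQn hX hsum hprod hx
    fun j hj => ne_zero_of_orderTop_eq_coe (orderTop_cfTail hb hd hxtop hj)
  have hcf := isCFExpansion_of_periodic (by omega) hb hd hxtop hper
  have hξ0 : cfTail (mercatBlock (pq α) n t k) (2 * n + 2) x (2 * n + 2 - 0 % (2 * n + 2)) = x := by
    rwa [Nat.zero_mod]
  constructor
  · intro M
    have := hcf.exists_lt_orderTop_sub_cfTrunc M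
    rwa [hξ0] at this
  · rw [← hξ0]
    refine hcf.KK_le ?_ fun i => ?_
    · rw [Nat.zero_mod, mercatBlock_zero, Polynomial.natDegree_C]
    · rcases mercatBlock_cases (a := pq α) (n := n) (t := t) (k := k)
        (Nat.mod_lt i (by omega : 0 < 2 * n + 2)) with ⟨-, h⟩ | ⟨j, h1, hj, -, -, h⟩
      · rw [h]
        exact zero_le
      · rw [h]
        exact le_iSup (fun m : {m : ℕ // 1 ≤ m ∧ cq α m ≠ 0} =>
          ((pq α m.1).natDegree : ℕ∞)) ⟨j, h1, cq_ne_zero_of_le hj hn⟩
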